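/- arXiv:1707.00215 — 2 statements merged into one kernel-verified Lean document; each statement's English description precedes it below -/
import Mathlib

section
/- Let G be a finitely generated group and H ≤ G a subgroup, and let D = G *_H G be the double of G along H, i.e. the amalgamated free product (pushout over the index type Bool) of two copies of the inclusion homomorphism H → G. If D is residually finite, then G is H-separable. -/
/-- A group is residually finite if every nontrivial element avoids some
finite-index normal subgroup. -/
def ResiduallyFinite (G : Type*) [Group G] : Prop :=
  ∀ g : G, g ≠ 1 → ∃ N : Subgroup G, N.Normal ∧ N.FiniteIndex ∧ g ∉ N

/-- The double `G *_H G` of a group along a subgroup: the pushout over `Bool` of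
two copies of the inclusion `H → G`. -/
abbrev GroupDouble {G : Type*} [Group G] (H : Subgroup G) :=
  Monoid.PushoutI (fun _ : Bool => H.subtype)

/-- The equalizer of two homomorphisms into a finite group has finite index. -/
theorem MonoidHom.finiteIndex_eqLocus {G Q : Type*} [Group G] [Group Q] [Finite Q]
    (a b : G →* Q) : (a.eqLocus b).FiniteIndex := by
  refine Subgroup.finiteIndex_of_le (H := a.ker ⊓ b.ker) fun x hx => ?_
  exact (MonoidHom.mem_ker.1 hx.1).trans (MonoidHom.mem_ker.1 hx.2).symm

/-- The two copies of `g` in the double agree only if `g` lies in the amalgamated subgroup. -/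
theorem GroupDouble.mem_of_of_eq {G : Type*} [Group G] {H : Subgroup G} {g : G}
    (h : (Monoid.PushoutI.of true g : GroupDouble H) = Monoid.PushoutI.of false g) : g ∈ H := by
  have hinj : ∀ _ : Bool, Function.Injective H.subtype := fun _ => H.subtype_injective
  have hmem : (Monoid.PushoutI.of true g : GroupDouble H) ∈
      (Monoid.PushoutI.base (fun _ : Bool => H.subtype)).range := by
    rw [← Monoid.PushoutI.inf_of_range_eq_base_range hinj (Bool.false_ne_true.symm)]
    exact ⟨⟨g, rfl⟩, ⟨g, h.symm⟩⟩
  obtain ⟨k, hk⟩ := hmem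
  rw [← Monoid.PushoutI.of_apply_eq_base (fun _ : Bool => H.subtype) true] at hk
  exact Monoid.PushoutI.of_injective hinj true hk ▸ k.2

/-- Wise: if the double `G *_H G` of a finitely generated group `G` along a subgroup `H`
is residually finite, then `G` is `H`-separable. -/
theorem double_residuallyFinite_implies_separable {G : Type*} [Group G]
    (hfg : Group.FG G) (H : Subgroup G)
    (hrf : ResiduallyFinite (GroupDouble H))
    (g : G) (hg : g ∉ H) :
    ∃ K : Subgroup G, K.FiniteIndex ∧ H ≤ K ∧ g ∉ K := by
  let ι (i : Bool) : G →* GroupDouble H := Monoid.PushoutI.of (G := fun _ : Bool => G) i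
  have hne : (ι true g)⁻¹ * ι false g ≠ 1 :=
    fun h => hg (GroupDouble.mem_of_of_eq (inv_mul_eq_one.1 h))
  obtain ⟨N, hN, hfin, hgN⟩ := hrf _ hne
  let π := QuotientGroup.mk' N
  refine ⟨(π.comp (ι true)).eqLocus (π.comp (ι false)),
    MonoidHom.finiteIndex_eqLocus _ _, fun k hk => ?_, fun h => hgN (QuotientGroup.eq.1 h)⟩
  have hbase (i : Bool) : ι i k = Monoid.PushoutI.base (fun _ : Bool => H.subtype) ⟨k, hk⟩ :=
    Monoid.PushoutI.of_apply_eq_base (fun _ : Bool => H.subtype) i ⟨k, hk⟩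
  exact congrArg π ((hbase true).trans (hbase false).symm)
end

section
/- Let A be a bireversible automaton. Suppose π₁(Δ_A) contains an anti-torus: there exist a ∈ ⟨S⟩ and b ∈ ⟨X⟩ such that aⁿbᵐ ≠ bᵐaⁿ for all nonzero integers n, m. Then the automaton group G_A is infinite. -/
/-- A Mealy automaton with state set `S` and alphabet `X`:
`λ(s,x) = (o s x, t s x)`. -/
structure Mealy (S X : Type) where
  o : S → X → X
  t : S → X → S

namespace Mealy

variable {S X : Type}

/-- Bireversibility of a Mealy automaton. -/
def Bireversible (M : Mealy S X) : Prop :=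
  (∀ s, Function.Bijective (M.o s)) ∧
  (∀ x, Function.Bijective (fun s => M.t s x)) ∧
  Function.Bijective (fun p : S × X => (M.o p.1 p.2, M.t p.1 p.2))

/-- The action of a state on words over the alphabet. -/
def actWord (M : Mealy S X) : S → List X → List X
  | _, [] => []
  | s, x :: w => M.o s x :: M.actWord (M.t s x) w

/-- The dual action of a letter on words over the states. -/
def dualActWord (M : Mealy S X) : X → List S → List S
  | _, [] => []
  | x, s :: w => M.t s x :: M.dualActWord (M.o s x) w

/-- The relators `s x (t s x)⁻¹ (o s x)⁻¹` of the square-complex group. -/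
def rels (M : Mealy S X) : Set (FreeGroup (S ⊕ X)) :=
  ⋃ (s : S) (x : X),
    {FreeGroup.of (Sum.inl s) * FreeGroup.of (Sum.inr x) *
      (FreeGroup.of (Sum.inl (M.t s x)))⁻¹ * (FreeGroup.of (Sum.inr (M.o s x)))⁻¹}

/-- The fundamental group `π₁(Δ_A)` of the square complex of the automaton. -/
abbrev Pi1 (M : Mealy S X) := PresentedGroup M.rels

/-- The image of a state in `π₁(Δ_A)`. -/
def genS (M : Mealy S X) (s : S) : M.Pi1 := PresentedGroup.of (Sum.inl s)

/-- The image of a letter in `π₁(Δ_A)`. -/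
def genX (M : Mealy S X) (x : X) : M.Pi1 := PresentedGroup.of (Sum.inr x)

/-- The subgroup `⟨S⟩` of `π₁(Δ_A)`. -/
def subS (M : Mealy S X) : Subgroup M.Pi1 := Subgroup.closure (Set.range M.genS)

/-- The subgroup `⟨X⟩` of `π₁(Δ_A)`. -/
def subX (M : Mealy S X) : Subgroup M.Pi1 := Subgroup.closure (Set.range M.genX)

/-- The automaton group `G_A`: the subgroup of `Perm (List X)` generated by the
permutations `σ_s` defined by the states. -/
def autGroup (M : Mealy S X) : Subgroup (Equiv.Perm (List X)) :=
  Subgroup.closure {σ : Equiv.Perm (List X) | ∃ s, ⇑σ = M.actWord s}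

/-- The dual automaton group `G_{∂A}`. -/
def dualAutGroup (M : Mealy S X) : Subgroup (Equiv.Perm (List S)) :=
  Subgroup.closure {τ : Equiv.Perm (List S) | ∃ x, ⇑τ = M.dualActWord x}

end Mealy

open scoped Pointwise

namespace Mealy

variable {S X : Type}

theorem genS_mul_genX (M : Mealy S X) (s : S) (x : X) :
    M.genS s * M.genX x = M.genX (M.o s x) * M.genS (M.t s x) := by
  have h : FreeGroup.of (Sum.inl s) * FreeGroup.of (Sum.inr x) *
      (FreeGroup.of (Sum.inl (M.t s x)))⁻¹ * (FreeGroup.of (Sum.inr (M.o s x)))⁻¹ ∈ M.rels :=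
    Set.mem_iUnion₂.2 ⟨s, x, rfl⟩
  have h1 := PresentedGroup.one_of_mem h
  simp only [map_mul, map_inv] at h1
  exact mul_inv_eq_iff_eq_mul.1 (mul_inv_eq_one.1 h1)

theorem actWord_bijective {M : Mealy S X} (ho : ∀ s, Function.Bijective (M.o s)) (s : S) :
    Function.Bijective (M.actWord s) := by
  constructor
  · intro v w h
    induction v generalizing s w with
    | nil => cases w <;> simp_all [actWord]
    | cons x v ih =>
      cases w with
      | nil => simp [actWord] at h
      | cons y w =>
        simp only [actWord, List.cons.injEq] at h
        obtain rfl := (ho s).1 h.1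
        rw [ih _ h.2]
  · intro w
    induction w generalizing s with
    | nil => exact ⟨[], rfl⟩
    | cons y w ih =>
      obtain ⟨x, rfl⟩ := (ho s).2 y
      obtain ⟨v, rfl⟩ := ih (M.t s x)
      exact ⟨x :: v, rfl⟩

/-- The permutation of words defined by a state of an invertible automaton. -/
noncomputable def statePerm {M : Mealy S X} (ho : ∀ s, Function.Bijective (M.o s)) (s : S) :
    Equiv.Perm (List X) :=
  Equiv.ofBijective (M.actWord s) (actWord_bijective ho s)

theorem statePerm_cons {M : Mealy S X} (ho : ∀ s, Function.Bijective (M.o s)) (s : S) (x : X)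
    (w : List X) :
    statePerm ho s (x :: w) = M.o s x :: statePerm ho (M.t s x) w := rfl

theorem statePerm_mem_autGroup {M : Mealy S X} (ho : ∀ s, Function.Bijective (M.o s)) (s : S) :
    statePerm ho s ∈ M.autGroup :=
  Subgroup.subset_closure ⟨s, rfl⟩

/-- A state, seen simultaneously in `π₁(Δ_A)` and in the automaton group. -/
noncomputable def statePair {M : Mealy S X} (ho : ∀ s, Function.Bijective (M.o s)) (s : S) :
    M.Pi1 × Equiv.Perm (List X) :=
  (M.genS s, statePerm ho s)

/-- The states and their inverses, seen simultaneously in `π₁(Δ_A)` and in the automaton group. -/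
def signedStates {M : Mealy S X} (ho : ∀ s, Function.Bijective (M.o s)) :
    Set (M.Pi1 × Equiv.Perm (List X)) :=
  Set.range (statePair ho) ∪ (Set.range (statePair ho))⁻¹

theorem signedStates_finite [Finite S] {M : Mealy S X} (ho : ∀ s, Function.Bijective (M.o s)) :
    (signedStates ho).Finite :=
  (Set.finite_range _).union (Set.finite_range _).inv

theorem signedStates_pow_finite [Finite S] {M : Mealy S X}
    (ho : ∀ s, Function.Bijective (M.o s)) (k : ℕ) : (signedStates ho ^ k).Finite := by
  induction k with
  | zero => rw [pow_zero]; exact Set.finite_one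
  | succ k ih => rw [pow_succ]; exact ih.mul (signedStates_finite ho)

theorem inv_signedStates {M : Mealy S X} (ho : ∀ s, Function.Bijective (M.o s)) :
    (signedStates ho)⁻¹ = signedStates ho := by
  rw [signedStates, Set.union_inv, inv_inv, Set.union_comm]

/-- Moving a letter across an element represented by a signed state word produces an element
represented by a signed state word of the same length. -/
theorem exists_section {M : Mealy S X} (ho : ∀ s, Function.Bijective (M.o s)) (k : ℕ)
    {p : M.Pi1 × Equiv.Perm (List X)} (hp : p ∈ signedStates ho ^ k) (x : X) :
    ∃ y, ∃ q ∈ signedStates ho ^ k, p.1 * M.genX x = M.genX y * q.1 ∧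
      ∀ w, p.2 (x :: w) = y :: q.2 w := by
  induction k generalizing p x with
  | zero =>
    rw [pow_zero, Set.mem_one] at hp
    subst hp
    exact ⟨x, 1, by simp, by simp, by simp⟩
  | succ k ih =>
    rw [pow_succ] at hp
    obtain ⟨p₁, hp₁, p₂, hp₂, rfl⟩ := Set.mem_mul.1 hp
    have key : ∃ y, ∃ q ∈ signedStates ho, p₂.1 * M.genX x = M.genX y * q.1 ∧
        ∀ w, p₂.2 (x :: w) = y :: q.2 w := by
      rcases hp₂ with ⟨s, rfl⟩ | ⟨s, hs⟩
      · exact ⟨M.o s x, statePair ho (M.t s x), Or.inl ⟨_, rfl⟩, M.genS_mul_genX s x,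
          statePerm_cons ho s x⟩
      · obtain rfl : p₂ = (statePair ho s)⁻¹ := by rw [hs, inv_inv]
        obtain ⟨y, rfl⟩ := (ho s).2 x
        refine ⟨y, (statePair ho (M.t s y))⁻¹, Or.inr ⟨M.t s y, (inv_inv _).symm⟩, ?_, fun w => ?_⟩
        · change (M.genS s)⁻¹ * M.genX (M.o s y) = M.genX y * (M.genS (M.t s y))⁻¹
          rw [inv_mul_eq_iff_eq_mul, ← mul_assoc, eq_mul_inv_iff_mul_eq, genS_mul_genX]
        · change (statePerm ho s)⁻¹ _ = _ :: (statePerm ho (M.t s y))⁻¹ w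
          rw [Equiv.Perm.inv_eq_iff_eq, statePerm_cons]
          exact congrArg _ (Equiv.apply_symm_apply _ w).symm
    obtain ⟨y, q₂, hq₂, h₂, h₂'⟩ := key
    obtain ⟨z, q₁, hq₁, h₁, h₁'⟩ := ih hp₁ y
    refine ⟨z, q₁ * q₂, pow_succ (signedStates ho) k ▸ Set.mul_mem_mul hq₁ hq₂, ?_, fun w => ?_⟩
    · rw [Prod.fst_mul, Prod.fst_mul, mul_assoc, h₂, ← mul_assoc, h₁, mul_assoc]
    · rw [Prod.snd_mul, Prod.snd_mul, Equiv.Perm.mul_apply, h₂', h₁', Equiv.Perm.mul_apply]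

theorem exists_mem_signedStates_pow {M : Mealy S X} (ho : ∀ s, Function.Bijective (M.o s))
    {a : M.Pi1} (ha : a ∈ M.subS) :
    ∃ π ∈ M.autGroup, ∃ k : ℕ, (a, π) ∈ signedStates ho ^ k := by
  induction ha using Subgroup.closure_induction with
  | mem a ha =>
    obtain ⟨s, rfl⟩ := ha
    exact ⟨statePerm ho s, statePerm_mem_autGroup ho s, 1, by
      rw [pow_one]; exact Or.inl ⟨s, rfl⟩⟩
  | one => exact ⟨1, one_mem _, 0, by rw [pow_zero]; rfl⟩
  | mul a b _ _ iha ihb =>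
    obtain ⟨π, hπ, k, hk⟩ := iha
    obtain ⟨ρ, hρ, l, hl⟩ := ihb
    exact ⟨π * ρ, mul_mem hπ hρ, k + l, pow_add (signedStates ho) k l ▸ Set.mul_mem_mul hk hl⟩
  | inv a _ iha =>
    obtain ⟨π, hπ, k, hk⟩ := iha
    refine ⟨π⁻¹, inv_mem hπ, k, ?_⟩
    rw [← inv_signedStates ho, inv_pow]
    exact Set.inv_mem_inv.2 hk

/-- The elements of `π₁(Δ_A)` represented by signed state words of length `k` that act trivially
on words. -/
def trivialWords {M : Mealy S X} (ho : ∀ s, Function.Bijective (M.o s)) (k : ℕ) : Set M.Pi1 :=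
  {g | (g, 1) ∈ signedStates ho ^ k}

theorem trivialWords_finite [Finite S] {M : Mealy S X} (ho : ∀ s, Function.Bijective (M.o s))
    (k : ℕ) : (trivialWords ho k).Finite :=
  (signedStates_pow_finite ho k).preimage (Prod.mk_left_injective _).injOn

theorem inv_genX_conj_mem_trivialWords {M : Mealy S X} (ho : ∀ s, Function.Bijective (M.o s))
    {k : ℕ} {g : M.Pi1} (hg : g ∈ trivialWords ho k) (x : X) :
    MulAut.conj (M.genX x)⁻¹ g ∈ trivialWords ho k := by
  obtain ⟨y, ⟨g', π⟩, hq, h, h'⟩ := exists_section ho k hg x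
  simp only [Equiv.Perm.one_apply, List.cons.injEq] at h h'
  obtain rfl := (h' []).1
  obtain rfl : π = 1 := Equiv.ext fun w => (h' w).2.symm
  rwa [MulAut.conj_apply, inv_inv, mul_assoc, h, inv_mul_cancel_left]

theorem conj_image_trivialWords [Finite S] {M : Mealy S X}
    (ho : ∀ s, Function.Bijective (M.o s)) (k : ℕ) {b : M.Pi1} (hb : b ∈ M.subX) :
    MulAut.conj b '' trivialWords ho k = trivialWords ho k := by
  suffices h : M.subX ≤ (MulAction.stabilizer (MulAut M.Pi1) (trivialWords ho k)).comap
      MulAut.conj from h hb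
  rw [subX, Subgroup.closure_le]
  rintro _ ⟨x, rfl⟩
  rw [SetLike.mem_coe, ← inv_mem_iff, Subgroup.mem_comap, MulAction.mem_stabilizer_iff]
  change MulAut.conj (M.genX x)⁻¹ '' trivialWords ho k = trivialWords ho k
  refine Set.eq_of_subset_of_ncard_le ?_ ?_ (trivialWords_finite ho k)
  · rintro _ ⟨g, hg, rfl⟩
    exact inv_genX_conj_mem_trivialWords ho hg x
  · rw [Set.ncard_image_of_injective _ (MulEquiv.injective _)]

end Mealy

open Mealy in
/-- If `π₁(Δ_A)` admits an anti-torus (elements `a ∈ ⟨S⟩`, `b ∈ ⟨X⟩` with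
`aⁿbᵐ ≠ bᵐaⁿ` for all nonzero `n, m`), then the automaton group `G_A` is infinite. -/
theorem antitorus_implies_infinite {S X : Type} [Finite S] [Finite X]
    [Nonempty S] [Nonempty X] (M : Mealy S X) (hb : M.Bireversible)
    (a b : M.Pi1) (haS : a ∈ M.subS) (hbX : b ∈ M.subX)
    (hanti : ∀ n m : ℤ, n ≠ 0 → m ≠ 0 → a ^ n * b ^ m ≠ b ^ m * a ^ n) :
    Infinite M.autGroup := by
  by_contra hfin
  rw [not_infinite_iff_finite] at hfin
  have ho := hb.1
  obtain ⟨π, hπ, k, hk⟩ := exists_mem_signedStates_pow ho haS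
  obtain ⟨n, hn, hπn⟩ := isOfFinOrder_iff_pow_eq_one.1
    (isOfFinOrder_of_finite (⟨π, hπ⟩ : M.autGroup))
  replace hπn : π ^ n = 1 := congrArg Subtype.val hπn
  have han : a ^ n ∈ trivialWords ho (k * n) := by
    have := Set.pow_mem_pow (n := n) hk
    rwa [← pow_mul, Prod.pow_mk, hπn] at this
  have hconj (m : ℕ) : MulAut.conj (b ^ m) (a ^ n) ∈ trivialWords ho (k * n) :=
    conj_image_trivialWords ho (k * n) (pow_mem hbX m) ▸ Set.mem_image_of_mem _ han
  obtain ⟨i, -, j, -, hij, h⟩ := Set.infinite_univ.exists_ne_map_eq_of_mapsTo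
    (fun m _ => hconj m) (trivialWords_finite ho (k * n))
  refine hanti n ((j : ℤ) - i) (by omega) (by omega) ?_
  rw [zpow_natCast, zpow_sub, zpow_natCast, zpow_natCast]
  simp only [MulAut.conj_apply] at h
  have hc : a ^ n = (b ^ i)⁻¹ * (b ^ j * a ^ n * (b ^ j)⁻¹) * b ^ i := by rw [← h]; group
  have hbb : b ^ j * (b ^ i)⁻¹ = (b ^ i)⁻¹ * b ^ j :=
    ((Commute.refl b).pow_pow j i).inv_right.eq
  have hbb' : (b ^ j)⁻¹ * b ^ i = b ^ i * (b ^ j)⁻¹ :=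
    ((Commute.refl b).pow_pow j i).inv_left.eq
  calc a ^ n * (b ^ j * (b ^ i)⁻¹)
      = (b ^ i)⁻¹ * b ^ j * a ^ n * ((b ^ j)⁻¹ * b ^ i) * (b ^ j * (b ^ i)⁻¹) := by
        conv_lhs => rw [hc]
        simp only [mul_assoc]
    _ = b ^ j * (b ^ i)⁻¹ * a ^ n := by rw [hbb', ← hbb]; group
end
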